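/- arXiv:2007.09096 — 2 statements merged into one kernel-verified Lean document; each statement's English description precedes it below -/
import Mathlib

section
/- Let V be an OCA with state set Q, let p, q be states and x, y ∈ ℕ. If p(x) →* q(y), then there exists a path π with p(x) →^π q(y) and |π| ≤ (|Q| + x + y)³. -/
namespace TVASSpaper

/-- Actions of a one-counter automaton: `some a` with `a ∈ {-1,0,+1}` is an
    addition, `none` is the zero-test `tst`. -/
abbrev OAct := Option ℤ

abbrev OTrans (Q : Type) := Q × OAct × Q

/-- A one-counter automaton: a finite set of transitions
    `Δ ⊆ Q × ({-1,0,+1} ∪ {tst}) × Q`. -/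
structure OCA (Q : Type) where
  trans : Finset (OTrans Q)
  small : ∀ t ∈ trans, ∀ a : ℤ, t.2.1 = some a → a.natAbs ≤ 1

variable {Q : Type}

/-- The step induced by a single transition of an OCA. -/
def OStepBy (t : OTrans Q) (c c' : Q × ℕ) : Prop :=
  t.1 = c.1 ∧ t.2.2 = c'.1 ∧
    match t.2.1 with
    | some a => (c'.2 : ℤ) = (c.2 : ℤ) + a
    | none => c.2 = 0 ∧ c'.2 = 0

/-- `ORun V c π c'` : there is a run from `c` to `c'` taking the steps of the
    word of transitions `π` in order. -/
inductive ORun (V : OCA Q) : Q × ℕ → List (OTrans Q) → Q × ℕ → Prop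
  | nil (c : Q × ℕ) : ORun V c [] c
  | cons {t : OTrans Q} {c c' c'' : Q × ℕ} {π : List (OTrans Q)} :
      t ∈ V.trans → OStepBy t c c' → ORun V c' π c'' → ORun V c (t :: π) c''

/-- Reachability `c →* c'` in an OCA. -/
def OReach (V : OCA Q) (c c' : Q × ℕ) : Prop := ∃ π, ORun V c π c'

/-- `OIsPathFrom V p π q` : `π` is a path of `V` from state `p` to state `q`. -/
inductive OIsPathFrom (V : OCA Q) : Q → List (OTrans Q) → Q → Prop
  | nil (p : Q) : OIsPathFrom V p [] p
  | cons {t : OTrans Q} {π : List (OTrans Q)} {q : Q} :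
      t ∈ V.trans → OIsPathFrom V t.2.2 π q → OIsPathFrom V t.1 (t :: π) q

/-- `n`-fold concatenation of a word. -/
def pw {α : Type*} (l : List α) (n : ℕ) : List α := (List.replicate n l).flatten

/-- A weighted one-counter automaton: an OCA with a weight function on
    transitions. -/
structure WOCA (Q : Type) extends OCA Q where
  wt : OTrans Q → ℤ

/-- The weight of a path: the sum of the weights of its transitions. -/
def wlen (W : WOCA Q) (π : List (OTrans Q)) : ℤ := (π.map W.wt).sum


/-- One step of an OCA between configurations. -/
def OStep (V : OCA Q) (c c' : Q × ℕ) : Prop := ∃ t ∈ V.trans, OStepBy t c c'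

lemma OStep.counter_le {V : OCA Q} {c c' : Q × ℕ} (h : OStep V c c') :
    c'.2 ≤ c.2 + 1 ∧ c.2 ≤ c'.2 + 1 := by
  obtain ⟨⟨s, a, s'⟩, ht, -, -, h⟩ := h
  cases a with
  | none => dsimp only at h; omega
  | some a =>
    have := V.small _ ht a rfl
    dsimp only at h
    omega

/-- Steps away from zero can be shifted down. -/
lemma OStep.sub {V : OCA Q} {c c' : Q × ℕ} (h : OStep V c c') {d : ℕ}
    (h0 : 0 < c.2) (hc : d ≤ c.2) (hc' : d ≤ c'.2) :
    OStep V (c.1, c.2 - d) (c'.1, c'.2 - d) := by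
  obtain ⟨⟨s, a, s'⟩, ht, hs, hs', h⟩ := h
  refine ⟨_, ht, hs, hs', ?_⟩
  cases a with
  | none => dsimp only at h; omega
  | some a => dsimp only at h ⊢; omega

lemma ORun.append {V : OCA Q} {c c' c'' : Q × ℕ} {π ρ : List (OTrans Q)}
    (h : ORun V c π c') (h' : ORun V c' ρ c'') : ORun V c (π ++ ρ) c'' := by
  induction h with
  | nil => exact h'
  | cons ht hs _ ih => exact .cons ht hs (ih h')

lemma ORun.exists_seq {V : OCA Q} {c c' : Q × ℕ} {π : List (OTrans Q)} (h : ORun V c π c') :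
    ∃ f : ℕ → Q × ℕ, f 0 = c ∧ f π.length = c' ∧ ∀ i < π.length, OStep V (f i) (f (i + 1)) := by
  induction h with
  | nil c => exact ⟨fun _ => c, rfl, rfl, by simp⟩
  | @cons t c _ _ _ ht hs _ ih =>
    obtain ⟨f, h0, h1, hf⟩ := ih
    refine ⟨fun i => Nat.casesOn i c f, rfl, h1, fun i hi => ?_⟩
    cases i with
    | zero => exact ⟨t, ht, by simpa [h0] using hs⟩
    | succ i => exact hf i (by simpa using hi)

lemma exists_run_of_seq {V : OCA Q} {f : ℕ → Q × ℕ} {a b : ℕ} (hab : a ≤ b)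
    (hf : ∀ i, a ≤ i → i < b → OStep V (f i) (f (i + 1))) :
    ∃ π, ORun V (f a) π (f b) ∧ π.length = b - a := by
  induction b, hab using Nat.le_induction with
  | base => exact ⟨[], .nil _, by simp⟩
  | succ b hab ih =>
    obtain ⟨π, hπ, hl⟩ := ih fun i hi hib => hf i hi (by omega)
    obtain ⟨t, ht, hs⟩ := hf b hab (by omega)
    exact ⟨π ++ [t], hπ.append (.cons ht hs (.nil _)), by simp; omega⟩

/-- The last visit to level `v` before time `m`. -/
lemma exists_last_visit {g : ℕ → ℕ} {v m : ℕ} (hg : ∀ i < m, g (i + 1) ≤ g i + 1)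
    (h0 : g 0 ≤ v) (hm : v ≤ g m) :
    ∃ i ≤ m, g i = v ∧ ∀ k, i ≤ k → k ≤ m → v ≤ g k := by
  induction m with
  | zero => exact ⟨0, le_rfl, by omega, fun k _ hk => by rwa [show k = 0 by omega]⟩
  | succ m ih =>
    by_cases he : g (m + 1) = v
    · exact ⟨m + 1, le_rfl, he, fun k h h' => by rwa [show k = m + 1 by omega]⟩
    · have := hg m (by omega)
      obtain ⟨i, hi, hv, hk⟩ := ih (fun i hi => hg i (by omega)) (by omega)
      refine ⟨i, by omega, hv, fun k h h' => ?_⟩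
      rcases Nat.lt_or_ge m k with h1 | h1
      · rwa [show k = m + 1 by omega]
      · exact hk k h h1

/-- The first visit to level `v` after time `m`. -/
lemma exists_first_visit {g : ℕ → ℕ} {v m L : ℕ} (hmL : m ≤ L)
    (hg : ∀ i < L, g i ≤ g (i + 1) + 1) (hL : g L ≤ v) (hm : v ≤ g m) :
    ∃ i, m ≤ i ∧ i ≤ L ∧ g i = v ∧ ∀ k, m ≤ k → k ≤ i → v ≤ g k := by
  obtain ⟨i, hi, hv, hk⟩ := exists_last_visit (g := fun i => g (L - i)) (v := v) (m := L - m)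
    (fun i hi => by
      have := hg (L - (i + 1)) (by omega)
      rwa [show L - (i + 1) + 1 = L - i by omega] at this)
    (by simpa using hL) (by simpa [Nat.sub_sub_self hmL] using hm)
  refine ⟨L - i, by omega, by omega, hv, fun k h h' => ?_⟩
  simpa [Nat.sub_sub_self (h'.trans (Nat.sub_le _ _))] using hk (L - k) (by omega) (by omega)

section Minimal

variable {V : OCA Q} {f : ℕ → Q × ℕ} {L : ℕ}

/-- A shortest run does not repeat a configuration. -/
lemma seq_ne_of_minimal (hf : ∀ i < L, OStep V (f i) (f (i + 1)))
    (hmin : ∀ π, ORun V (f 0) π (f L) → L ≤ π.length) {i j : ℕ} (hij : i < j) (hj : j ≤ L) :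
    f i ≠ f j := by
  intro he
  obtain ⟨π, hπ, hl⟩ := exists_run_of_seq (Nat.zero_le i) fun k _ hk => hf k (by omega)
  obtain ⟨ρ, hρ, hl'⟩ := exists_run_of_seq hj fun k _ hk => hf k hk
  have := hmin _ (hπ.append (he ▸ hρ))
  simp only [List.length_append] at this
  omega

/-- A shortest run exceeds its endpoints by less than the squared number of states. -/
lemma seq_lt_of_minimal [Fintype Q] (hf : ∀ i < L, OStep V (f i) (f (i + 1)))
    (hmin : ∀ π, ORun V (f 0) π (f L) → L ≤ π.length) {m : ℕ} (hm : m ≤ L) :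
    (f m).2 < max (f 0).2 (f L).2 + Fintype.card Q ^ 2 := by
  by_contra! hlt
  set M := max (f 0).2 (f L).2
  have hleft (v : Fin (Fintype.card Q ^ 2 + 1)) :=
    exists_last_visit (g := fun i => (f i).2) (v := M + v) (m := m)
      (fun i hi => (hf i (by omega)).counter_le.1) (by omega)
      (by have := v.isLt; omega)
  have hright (v : Fin (Fintype.card Q ^ 2 + 1)) :=
    exists_first_visit (g := fun i => (f i).2) (v := M + v) hm
      (fun i hi => (hf i hi).counter_le.2) (by omega)
      (by have := v.isLt; omega)
  choose l hlm hlv hlk using hleft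
  choose r hrm hrL hrv hrk using hright
  obtain ⟨u, v, huv, he⟩ : ∃ u v, u < v ∧ ((f (l u)).1, (f (r u)).1) =
      ((f (l v)).1, (f (r v)).1) := by
    obtain ⟨u, v, hne, he⟩ := Fintype.exists_ne_map_eq_of_card_lt
      (fun v => ((f (l v)).1, (f (r v)).1)) (by simp [sq])
    rcases hne.lt_or_gt with h | h
    · exact ⟨u, v, h, he⟩
    · exact ⟨v, u, h, he.symm⟩
  obtain ⟨hel, her⟩ := Prod.mk.inj he
  replace huv : (u : ℕ) < v := huv
  have hl : l u < l v := by
    by_contra! h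
    have := hlk v (l u) h (hlm u)
    have := hlv u
    omega
  have hr : r v < r u := by
    by_contra! h
    have := hrk v (r u) (hrm u) h
    have := hrv u
    omega
  have hge (k : ℕ) (h : l v ≤ k) (h' : k ≤ r v) : M + v ≤ (f k).2 := by
    rcases le_total k m with hkm | hkm
    · exact hlk v k h hkm
    · exact hrk v k hkm h'
  obtain ⟨π, hπ, hπl⟩ := exists_run_of_seq (Nat.zero_le (l u)) fun k _ hk =>
    hf k (by have := hlm u; omega)
  obtain ⟨σ, hσ, hσl⟩ := exists_run_of_seq (V := V)
    (f := fun i => ((f i).1, (f i).2 - (v - u : ℕ))) ((hlm v).trans (hrm v)) fun k h h' => by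
      have h1 := hge k h h'.le
      have h2 := hge (k + 1) (by omega) h'
      exact (hf k (by have := hrL v; omega)).sub (by omega) (by omega) (by omega)
  obtain ⟨ρ, hρ, hρl⟩ := exists_run_of_seq (hrL u) fun k _ hk => hf k hk
  have e1 : ((f (l v)).1, (f (l v)).2 - (v - u : ℕ)) = f (l u) :=
    Prod.ext hel.symm (by have := hlv u; have := hlv v; dsimp only; omega)
  have e2 : ((f (r v)).1, (f (r v)).2 - (v - u : ℕ)) = f (r u) :=
    Prod.ext her.symm (by have := hrv u; have := hrv v; dsimp only; omega)
  rw [e1, e2] at hσ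
  have := hmin _ ((hπ.append hσ).append hρ)
  simp only [List.length_append] at this
  have := hlm v
  have := hrm v
  have := hrL u
  omega

/-- A shortest run has at most cubically many configurations. -/
lemma length_lt_of_minimal [Fintype Q] (hf : ∀ i < L, OStep V (f i) (f (i + 1)))
    (hmin : ∀ π, ORun V (f 0) π (f L) → L ≤ π.length) :
    L < Fintype.card Q * (max (f 0).2 (f L).2 + Fintype.card Q ^ 2) := by
  let F (i : Fin (L + 1)) : Q × Fin (max (f 0).2 (f L).2 + Fintype.card Q ^ 2) :=
    ((f i).1, ⟨(f i).2, seq_lt_of_minimal hf hmin (Nat.lt_succ_iff.1 i.isLt)⟩)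
  have hF : Function.Injective F := by
    intro i j hij
    have hij : f i = f j := by
      simp only [F, Prod.mk.injEq, Fin.mk.injEq] at hij
      exact Prod.ext hij.1 hij.2
    rcases lt_trichotomy i j with h | h | h
    · exact absurd hij (seq_ne_of_minimal hf hmin h (by omega))
    · exact h
    · exact absurd hij.symm (seq_ne_of_minimal hf hmin h (by omega))
  simpa [Nat.succ_le_iff] using Fintype.card_le_of_injective F hF

end Minimal

/-- Lemma: short runs in one-counter automata. -/
theorem oca_short_runs (Q : Type) [Fintype Q] [Nonempty Q]
    (V : OCA Q) (p q : Q) (x y : ℕ)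
    (h : OReach V (p, x) (q, y)) :
    ∃ π, ORun V (p, x) π (q, y) ∧ π.length ≤ (Fintype.card Q + x + y) ^ 3 := by
  classical
  have hex : ∃ n, ∃ π, ORun V (p, x) π (q, y) ∧ π.length = n :=
    let ⟨π, hπ⟩ := h
    ⟨_, π, hπ, rfl⟩
  obtain ⟨π, hπ, hl⟩ := Nat.find_spec hex
  refine ⟨π, hπ, ?_⟩
  obtain ⟨f, h0, h1, hf⟩ := hπ.exists_seq
  have hlt := length_lt_of_minimal hf fun ρ hρ =>
    hl.le.trans (Nat.find_min' hex ⟨ρ, by rwa [h0, h1] at hρ, rfl⟩)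
  rw [h0, h1] at hlt
  have hn : 1 ≤ Fintype.card Q := Fintype.card_pos
  have hxy : max x y ≤ x + y := by omega
  dsimp only at hlt
  generalize Fintype.card Q = n at *
  calc π.length ≤ n * (max x y + n ^ 2) := hlt.le
    _ ≤ (n + x + y) * (n + x + y) ^ 2 := by
      gcongr
      · omega
      · nlinarith [Nat.zero_le (n * (x + y)), Nat.mul_le_mul_right (x + y) hn, sq_nonneg (x + y)]
    _ = _ := by ring

end TVASSpaper
end

section
/- Let β be a feasible cycle in a d-TVASS on a state q containing at least one zero-test transition. For all x⃗, y⃗ ∈ ℕ^d and all n ∈ ℕ with n ≥ 1: q(x⃗) →^{βⁿ} q(y⃗) if and only if x⃗ ≥₁ m_β, y⃗ ≥₁ m_{β̄}, and y⃗ = x⃗ + n·Δ(β). -/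
namespace TVASSpaper

/-- Actions of a `d`-TVASS: `some a` is an addition of the vector `a ∈ ℤ^d`,
    `none` is the zero-test action `tst` (on the first counter). -/
abbrev Act (d : ℕ) := Option (Fin d → ℤ)

/-- Transitions. -/
abbrev Trans (d : ℕ) (Q : Type) := Q × Act d × Q

/-- Configurations: a state together with a vector of `d` counters. -/
abbrev Config (d : ℕ) (Q : Type) := Q × (Fin d → ℕ)

/-- A `d`-TVASS: a finite set `acts` of actions and a finite set of transitions
    `trans ⊆ Q × acts × Q`. The state set `Q` is a (finite, nonempty) type. -/
structure TVASS (d : ℕ) (Q : Type) where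
  acts : Finset (Act d)
  trans : Finset (Trans d Q)
  mem_acts : ∀ t ∈ trans, t.2.1 ∈ acts

variable {d : ℕ} {Q : Type}

/-- The step induced by a single transition: an addition transition `(p, a, q)`
    induces `p(x) → q(x + a)` whenever `x + a ∈ ℕ^d`; a zero-test transition
    `(p, tst, q)` induces `p(x) → q(x)` whenever the first counter is `0`. -/
def StepBy [NeZero d] (t : Trans d Q) (c c' : Config d Q) : Prop :=
  t.1 = c.1 ∧ t.2.2 = c'.1 ∧
    match t.2.1 with
    | some a => ∀ i, (c'.2 i : ℤ) = (c.2 i : ℤ) + a i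
    | none => c.2 0 = 0 ∧ c'.2 = c.2

/-- `Run V c π c'` : there is a run from `c` to `c'` taking the steps of the
    word of transitions `π` in order. -/
inductive Run [NeZero d] (V : TVASS d Q) :
    Config d Q → List (Trans d Q) → Config d Q → Prop
  | nil (c : Config d Q) : Run V c [] c
  | cons {t : Trans d Q} {c c' c'' : Config d Q} {π : List (Trans d Q)} :
      t ∈ V.trans → StepBy t c c' → Run V c' π c'' → Run V c (t :: π) c''

/-- One step of the TVASS. -/
def Step [NeZero d] (V : TVASS d Q) (c c' : Config d Q) : Prop :=
  ∃ t ∈ V.trans, StepBy t c c'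

/-- Reachability `c →* c'`. -/
def Reach [NeZero d] (V : TVASS d Q) (c c' : Config d Q) : Prop :=
  ∃ π, Run V c π c'

/-- `IsPathFrom V p π q` : `π` is a path (word of transitions of `V` with
    matching endpoints) from state `p` to state `q`. -/
inductive IsPathFrom (V : TVASS d Q) : Q → List (Trans d Q) → Q → Prop
  | nil (p : Q) : IsPathFrom V p [] p
  | cons {t : Trans d Q} {π : List (Trans d Q)} {q : Q} :
      t ∈ V.trans → IsPathFrom V t.2.2 π q → IsPathFrom V t.1 (t :: π) q

/-- A linear path scheme `α₀ β₁* α₁ ⋯ β_k* α_k`, given by the head path `α₀`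
    and the list of pairs `(β₁, α₁), …, (β_k, α_k)`. -/
structure LPS (d : ℕ) (Q : Type) where
  head : List (Trans d Q)
  rest : List (List (Trans d Q) × List (Trans d Q))

/-- Length `|L|` of a linear path scheme. -/
def LPS.len (L : LPS d Q) : ℕ :=
  L.head.length + (L.rest.map fun p => p.1.length + p.2.length).sum

/-- Number of stars `|L|_*` of a linear path scheme. -/
def LPS.stars (L : LPS d Q) : ℕ := L.rest.length

def wordRest : List (List (Trans d Q) × List (Trans d Q)) → List ℕ → List (Trans d Q)
  | [], _ => []
  | p :: rest, ns => pw p.1 (ns.headD 0) ++ p.2 ++ wordRest rest ns.tail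

/-- The word `α₀ β₁^{n₁} α₁ ⋯ β_k^{n_k} α_k` of `L` for exponents `ns`. -/
def LPS.word (L : LPS d Q) (ns : List ℕ) : List (Trans d Q) :=
  L.head ++ wordRest L.rest ns

/-- Well-formedness of the tail of a linear path scheme starting in state `s`:
    the `βᵢ` are cycles and the `αᵢ` are paths, with matching endpoints. -/
inductive ChainLPS (V : TVASS d Q) :
    Q → List (List (Trans d Q) × List (Trans d Q)) → Q → Prop
  | nil (q : Q) : ChainLPS V q [] q
  | cons {s s' q : Q} {β α : List (Trans d Q)}
      {rest : List (List (Trans d Q) × List (Trans d Q))} :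
      IsPathFrom V s β s → IsPathFrom V s α s' → ChainLPS V s' rest q →
      ChainLPS V s ((β, α) :: rest) q

/-- `L` is a genuine linear path scheme from `p` to `q` in `V`. -/
def IsLPS (V : TVASS d Q) (p : Q) (L : LPS d Q) (q : Q) : Prop :=
  ∃ s, IsPathFrom V p L.head s ∧ ChainLPS V s L.rest q

/-- `c →^L c'` : reachability along the linear path scheme `L`. -/
def ReachLPS [NeZero d] (V : TVASS d Q) (L : LPS d Q) (c c' : Config d Q) : Prop :=
  ∃ ns, Run V c (L.word ns) c'

/-- `‖x⃗‖`: maximum component of a vector of naturals. -/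
def vnorm {d : ℕ} (v : Fin d → ℕ) : ℕ := Finset.univ.sup v

/-- Maximum absolute value of a component of an integer vector. -/
def vnormZ {d : ℕ} (v : Fin d → ℤ) : ℕ := Finset.univ.sup fun i => (v i).natAbs

/-- `‖Σ‖`: maximum absolute value of a component of a vector in `Σ ∖ {tst}`
    (0 if `Σ ⊆ {tst}`). -/
def TVASS.actNorm (V : TVASS d Q) : ℕ :=
  V.acts.sup fun a => a.elim 0 vnormZ

/-- Displacement of a word of transitions (zero-tests contribute `0`). -/
def disp (π : List (Trans d Q)) : Fin d → ℤ :=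
  fun i => (π.map fun t => (t.2.1.elim 0 id : Fin d → ℤ) i).sum

/-- `m_π(i)`: max over prefixes `α` of `π` (including the empty prefix) of `-Δ(α)(i)`. -/
def mpre (π : List (Trans d Q)) (i : Fin d) : ℤ :=
  (π.inits.map fun α => -(disp α i)).foldr max 0

/-- `m_π̄(i)`: max over suffixes `σ` of `π` (including the empty suffix) of `Δ(σ)(i)`. -/
def msuf (π : List (Trans d Q)) (i : Fin d) : ℤ :=
  (π.tails.map fun σ => disp σ i).foldr max 0

/-- `π` contains no zero-test transition. -/
def noTst (π : List (Trans d Q)) : Prop := ∀ t ∈ π, t.2.1 ≠ none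

/-- `x⃗ ≥₁ m⃗` : `x⃗(1) = m⃗(1)` and `x⃗(i) ≥ m⃗(i)` for all other `i`. -/
def ge1 [NeZero d] (x : Fin d → ℕ) (m : Fin d → ℤ) : Prop :=
  (x 0 : ℤ) = m 0 ∧ ∀ i : Fin d, i ≠ 0 → m i ≤ (x i : ℤ)

/-- A path from `p` to `q` is feasible if some run takes it. -/
def Feasible [NeZero d] (V : TVASS d Q) (p : Q) (π : List (Trans d Q)) (q : Q) : Prop :=
  ∃ x y, Run V (p, x) π (q, y)

/-- `c →^{A* ∪ T} c'` : there is a run from `c` to `c'` whose path either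
    contains no zero-test transition, or is a single zero-test transition. -/
def ReachAT [NeZero d] (V : TVASS d Q) (c c' : Config d Q) : Prop :=
  ∃ π, Run V c π c' ∧ (noTst π ∨ ∃ t : Trans d Q, π = [t] ∧ t.2.1 = none)

/-- `p ⇝ q` for a 2-TVASS: `p(0, x) →* q(0, y)` for some `x, y ∈ ℕ`. -/
def Leads (V : TVASS 2 Q) (p q : Q) : Prop :=
  ∃ x y : ℕ, Reach V (p, ![0, x]) (q, ![0, y])

/-- The linear path scheme `L` is bounded from the configuration `c`: the set of
    configurations reachable from `c` along a prefix of a path in `L` is finite. -/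
def BoundedLPS [NeZero d] (V : TVASS d Q) (L : LPS d Q) (c : Config d Q) : Prop :=
  {c' : Config d Q | ∃ ns ρ, ρ <+: L.word ns ∧ Run V c ρ c'}.Finite


/-- The effect of a single transition (zero-tests contribute `0`). -/
def effect (t : Trans d Q) : Fin d → ℤ := t.2.1.elim 0 id

/-- Along `π`, started with first counter `z`, every zero-test sees the value `0`. -/
def TestsPass [NeZero d] : ℤ → List (Trans d Q) → Prop
  | _, [] => True
  | z, t :: π => (t.2.1 = none → z = 0) ∧ TestsPass (z + effect t 0) π

theorem disp_nil (i : Fin d) : disp ([] : List (Trans d Q)) i = 0 := rfl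

theorem disp_cons (t : Trans d Q) (π : List (Trans d Q)) (i : Fin d) :
    disp (t :: π) i = effect t i + disp π i := by
  simp [disp, effect]

theorem mpre_nil (i : Fin d) : mpre ([] : List (Trans d Q)) i = 0 := rfl

theorem mpre_nonneg (π : List (Trans d Q)) (i : Fin d) : 0 ≤ mpre π i := by
  cases π <;> simp [mpre, disp]

theorem foldr_max_zero_map_sub {α : Type*} (f : α → ℤ) (a : ℤ) (l : List α) :
    max 0 ((l.map fun x => f x - a).foldr max 0) =
      max 0 ((l.map f).foldr max (min 0 a) - a) := by
  induction l with
  | nil => simp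
  | cons b l ih => simp only [List.map_cons, List.foldr_cons]; omega

theorem foldr_max_eq_of_mem {l : List ℤ} (h : (0 : ℤ) ∈ l) {c : ℤ} (hc : c ≤ 0) :
    l.foldr max c = l.foldr max 0 := by
  have key : ∀ l : List ℤ, max 0 (l.foldr max c) = l.foldr max 0 := by
    intro l
    induction l with
    | nil => simpa using hc
    | cons b l ih => simp only [List.foldr_cons]; omega
  have hle : ∀ l : List ℤ, (0 : ℤ) ∈ l → 0 ≤ l.foldr max c := by
    intro l
    induction l with
    | nil => simp
    | cons b l ih =>
      intro hm
      rcases List.mem_cons.1 hm with rfl | hm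
      · simp
      · exact (ih hm).trans (le_max_right _ _)
  rw [← key l, max_eq_right (hle l h)]

theorem mpre_cons (t : Trans d Q) (π : List (Trans d Q)) (i : Fin d) :
    mpre (t :: π) i = max 0 (mpre π i - effect t i) := by
  have h0 : (0 : ℤ) ∈ π.inits.map fun α => -(disp α i) :=
    List.mem_map.2 ⟨[], by simp, by simp [disp_nil]⟩
  have h := foldr_max_zero_map_sub (fun α : List (Trans d Q) => -(disp α i))
    (effect t i) π.inits
  rw [foldr_max_eq_of_mem h0 (min_le_left _ _)] at h
  rw [mpre, mpre, ← h]
  simp only [List.inits_cons, List.map_cons, List.map_map, List.foldr_cons, disp_nil,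
    Function.comp_def, disp_cons, neg_zero, neg_add']
  simp only [sub_eq_add_neg, add_comm]

theorem msuf_eq (π : List (Trans d Q)) (i : Fin d) : msuf π i = mpre π i + disp π i := by
  induction π with
  | nil => rfl
  | cons t π ih =>
    have h : msuf (t :: π) i = max (disp (t :: π) i) (msuf π i) := by simp [msuf]
    rw [h, ih, mpre_cons, disp_cons]
    omega

theorem TestsPass.eq_mpre [NeZero d] {z : ℤ} {π : List (Trans d Q)} (h : TestsPass z π)
    (hz : mpre π 0 ≤ z) (htst : ∃ t ∈ π, t.2.1 = (none : Act d)) : z = mpre π 0 := by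
  induction π generalizing z with
  | nil => simp at htst
  | cons t π ih =>
    obtain ⟨h1, h2⟩ := h
    have h0 := mpre_nonneg (t :: π) 0
    by_cases ht : t.2.1 = none
    · have := h1 ht
      omega
    · rw [mpre_cons] at hz h0 ⊢
      have := ih h2 (by omega) (by simpa [ht] using htst)
      omega

theorem StepBy.add_effect [NeZero d] {t : Trans d Q} {c c' : Config d Q} (h : StepBy t c c')
    (i : Fin d) : (c'.2 i : ℤ) = c.2 i + effect t i := by
  obtain ⟨p, _ | a, r⟩ := t
  · simp [effect, h.2.2.2]
  · exact h.2.2 i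

theorem stepBy_of_add_effect [NeZero d] {t : Trans d Q} {x y : Fin d → ℕ}
    (htst : t.2.1 = none → x 0 = 0) (h : ∀ i, (y i : ℤ) = x i + effect t i) :
    StepBy t (t.1, x) (t.2.2, y) := by
  obtain ⟨p, _ | a, r⟩ := t
  · refine ⟨rfl, rfl, htst rfl, funext fun i => ?_⟩
    simpa [effect] using h i
  · exact ⟨rfl, rfl, h⟩

theorem Run.mpre_le [NeZero d] {V : TVASS d Q} {c c' : Config d Q} {π : List (Trans d Q)}
    (h : Run V c π c') (i : Fin d) : mpre π i ≤ c.2 i := by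
  induction h with
  | nil c => simp [mpre_nil]
  | cons _ hs _ ih =>
    have := hs.add_effect i
    rw [mpre_cons]
    omega

theorem Run.add_disp [NeZero d] {V : TVASS d Q} {c c' : Config d Q} {π : List (Trans d Q)}
    (h : Run V c π c') (i : Fin d) : (c'.2 i : ℤ) = c.2 i + disp π i := by
  induction h with
  | nil c => simp [disp_nil]
  | cons _ hs _ ih =>
    have := hs.add_effect i
    rw [disp_cons]
    omega

theorem Run.testsPass [NeZero d] {V : TVASS d Q} {c c' : Config d Q} {π : List (Trans d Q)}
    (h : Run V c π c') : TestsPass (c.2 0) π := by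
  induction h with
  | nil c => trivial
  | @cons t c c' c'' π _ hs _ ih =>
    refine ⟨fun ht => ?_, hs.add_effect 0 ▸ ih⟩
    obtain ⟨-, -, h⟩ := hs
    rw [ht] at h
    exact_mod_cast h.1

theorem IsPathFrom.run_of_testsPass [NeZero d] {V : TVASS d Q} {p q : Q}
    {π : List (Trans d Q)} (hπ : IsPathFrom V p π q) {x y : Fin d → ℕ}
    (hx : ∀ i, mpre π i ≤ x i) (hy : ∀ i, (y i : ℤ) = x i + disp π i)
    (ht : TestsPass (x 0) π) : Run V (p, x) π (q, y) := by
  induction hπ generalizing x with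
  | nil p =>
    have : y = x := funext fun i => by simpa [disp_nil] using hy i
    exact this ▸ Run.nil _
  | @cons t π q hmem _ ih =>
    have hz : ∀ i, (((x i + effect t i).toNat : ℕ) : ℤ) = x i + effect t i := fun i => by
      have h1 := hx i
      have h2 := mpre_nonneg π i
      rw [mpre_cons] at h1
      omega
    refine Run.cons hmem (stepBy_of_add_effect (fun h => by exact_mod_cast ht.1 h) hz)
      (ih (fun i => ?_) (fun i => ?_) ?_)
    · have := hx i
      rw [mpre_cons] at this
      have := hz i
      omega
    · have := hy i
      rw [disp_cons] at this
      have := hz i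
      omega
    · rw [hz 0]
      exact ht.2

theorem Run.state_eq [NeZero d] {V : TVASS d Q} {p q : Q} {π : List (Trans d Q)}
    {c c' : Config d Q} (h : Run V c π c') (hπ : IsPathFrom V p π q) (hc : c.1 = p) :
    c'.1 = q := by
  induction hπ generalizing c with
  | nil p => cases h; exact hc
  | cons _ _ ih =>
    cases h with
    | cons _ hs hr => exact ih hr hs.2.1.symm

theorem run_append [NeZero d] {V : TVASS d Q} {c c' : Config d Q} {π ρ : List (Trans d Q)} :
    Run V c (π ++ ρ) c' ↔ ∃ e, Run V c π e ∧ Run V e ρ c' := by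
  induction π generalizing c with
  | nil =>
    refine ⟨fun h => ⟨c, .nil c, h⟩, ?_⟩
    rintro ⟨e, h, h'⟩
    cases h
    exact h'
  | cons t π ih =>
    constructor
    · intro h
      cases h with
      | cons hm hs hr =>
        obtain ⟨e, h1, h2⟩ := ih.1 hr
        exact ⟨e, .cons hm hs h1, h2⟩
    · rintro ⟨e, h, h'⟩
      cases h with
      | cons hm hs hr => exact .cons hm hs (ih.2 ⟨e, hr, h'⟩)

theorem pw_succ {α : Type*} (l : List α) (n : ℕ) : pw l (n + 1) = l ++ pw l n := by
  simp [pw, List.replicate_succ]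

/-- A feasible path with a zero-test runs exactly from the vectors `x ≥₁ m_π`. -/
theorem IsPathFrom.run_iff_ge1 [NeZero d] {V : TVASS d Q} {p q : Q} {π : List (Trans d Q)}
    (hπ : IsPathFrom V p π q) (hfeas : Feasible V p π q)
    (htst : ∃ t ∈ π, t.2.1 = (none : Act d)) {x y : Fin d → ℕ} :
    Run V (p, x) π (q, y) ↔ ge1 x (mpre π) ∧ ∀ i, (y i : ℤ) = x i + disp π i := by
  constructor
  · exact fun h => ⟨⟨h.testsPass.eq_mpre (h.mpre_le 0) htst, fun i _ => h.mpre_le i⟩, h.add_disp⟩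
  · rintro ⟨⟨hx0, hx⟩, hy⟩
    obtain ⟨x', y', h⟩ := hfeas
    have hx' : (x' 0 : ℤ) = mpre π 0 := h.testsPass.eq_mpre (h.mpre_le 0) htst
    refine hπ.run_of_testsPass (fun i => ?_) hy ?_
    · by_cases hi : i = 0
      · exact hi ▸ hx0.ge
      · exact hx i hi
    · rw [hx0, ← hx']
      exact h.testsPass

/-- Claim: characterization of iterated feasible cycles with a zero-test. -/
theorem run_cycle_with_test_iff (d : ℕ) [NeZero d] (Q : Type) [Fintype Q] [Nonempty Q]
    (V : TVASS d Q) (q : Q) (β : List (Trans d Q))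
    (hcyc : IsPathFrom V q β q)
    (hfeas : Feasible V q β q)
    (htst : ∃ t ∈ β, t.2.1 = (none : Act d))
    (x y : Fin d → ℕ) (n : ℕ) (hn : 1 ≤ n) :
    Run V (q, x) (pw β n) (q, y) ↔
      ge1 x (mpre β) ∧ ge1 y (msuf β) ∧
      (∀ i, (y i : ℤ) = (x i : ℤ) + (n : ℤ) * disp β i) := by
  obtain ⟨n, rfl⟩ := Nat.exists_eq_add_of_le' hn
  clear hn
  have hrun {x y : Fin d → ℕ} := hcyc.run_iff_ge1 hfeas htst (x := x) (y := y)
  induction n generalizing x with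
  | zero =>
    rw [pw_succ, show pw β 0 = [] from rfl, List.append_nil, hrun]
    simp only [zero_add, Nat.cast_one, one_mul]
    refine ⟨fun ⟨hx, hy⟩ => ⟨hx, ⟨?_, fun i hi => ?_⟩, hy⟩, fun ⟨hx, _, hy⟩ => ⟨hx, hy⟩⟩
    · rw [msuf_eq, hy, hx.1]
    · rw [msuf_eq, hy]
      have := hx.2 i hi
      omega
  | succ n ih =>
    rw [pw_succ, run_append]
    constructor
    · rintro ⟨⟨r, z⟩, h1, h2⟩
      obtain rfl : r = q := h1.state_eq hcyc rfl
      obtain ⟨hx, hz⟩ := hrun.1 h1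
      obtain ⟨-, hy, hyz⟩ := (ih z).1 h2
      refine ⟨hx, hy, fun i => ?_⟩
      rw [hyz, hz]
      push_cast
      ring
    · rintro ⟨hx, hy, hxy⟩
      have hle : ∀ i, i ≠ 0 → mpre β i ≤ x i + disp β i := fun i hi => by
        have h1 := hx.2 i hi
        have h2 := hy.2 i hi
        rw [msuf_eq, hxy] at h2
        push_cast at h2
        rcases le_total 0 (disp β i) with h | h
        · omega
        · nlinarith [mul_nonneg (Int.natCast_nonneg n) (neg_nonneg.2 h)]
      have hD : disp β 0 = 0 := by
        have h2 := hy.1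
        rw [msuf_eq, hxy, hx.1] at h2
        push_cast at h2
        have h3 : ((n : ℤ) + 1) * disp β 0 = 0 := by linarith
        exact (mul_eq_zero.1 h3).resolve_left (by positivity)
      have hz : ∀ i, (((x i + disp β i).toNat : ℕ) : ℤ) = x i + disp β i := fun i => by
        by_cases hi : i = 0
        · subst hi
          omega
        · have := hle i hi
          have := mpre_nonneg β i
          omega
      refine ⟨(q, fun i => (x i + disp β i).toNat), hrun.2 ⟨hx, hz⟩,
        (ih _).2 ⟨⟨?_, fun i hi => ?_⟩, hy, fun i => ?_⟩⟩
      · rw [hz, hD, hx.1, add_zero]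
      · rw [hz]
        exact hle i hi
      · rw [hz, hxy]
        push_cast
        ring

end TVASSpaper
end
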